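/- arXiv:2011.09992 — 5 statements merged into one kernel-verified Lean document; each statement's English description precedes it below -/
import Mathlib

section
/- Let 𝔤 be an almost abelian real Lie algebra with abelian ideal 𝔫 of codimension one, and let J be an abelian complex structure on 𝔤. Then [X, Y] = 0 for every X ∈ 𝔤 and every Y ∈ 𝔫 ∩ J(𝔫); consequently the derived algebra [𝔤, 𝔤] has dimension at most 1. -/
/-- A subspace of codimension one together with any vector outside it spans the space. -/
theorem Submodule.exists_sub_smul_mem_of_finrank_add_one {K V : Type*} [DivisionRing K]
    [AddCommGroup V] [Module K V] [FiniteDimensional K V] {W : Submodule K V}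
    (hW : Module.finrank K W + 1 = Module.finrank K V) {t : V} (ht : t ∉ W) (x : V) :
    ∃ a : K, x - a • t ∈ W := by
  have hlt : W < W ⊔ K ∙ t :=
    left_lt_sup.mpr fun h => ht (h (mem_span_singleton_self t))
  have htop : W ⊔ K ∙ t = ⊤ := by
    have := finrank_lt_finrank_of_lt hlt
    have := finrank_le (W ⊔ K ∙ t)
    exact eq_top_of_finrank_eq (by omega)
  have hx : x ∈ W ⊔ K ∙ t := htop ▸ mem_top
  obtain ⟨w, hw, z, hz, rfl⟩ := mem_sup.mp hx
  obtain ⟨a, rfl⟩ := mem_span_singleton.mp hz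
  exact ⟨a, by simpa using hw⟩

/-- A real hyperplane is not invariant under a complex structure. -/
theorem exists_mem_apply_notMem_of_complex_structure {V : Type*} [AddCommGroup V] [Module ℝ V]
    [FiniteDimensional ℝ V] {W : Submodule ℝ V}
    (hW : Module.finrank ℝ W + 1 = Module.finrank ℝ V) (J : V →ₗ[ℝ] V)
    (hJ : ∀ x, J (J x) = -x) : ∃ e ∈ W, J e ∉ W := by
  by_contra! h
  have hne : W ≠ ⊤ := by
    rintro rfl
    simp at hW
  obtain ⟨t, ht⟩ : ∃ t, t ∉ W := by
    by_contra! h'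
    exact hne (Submodule.eq_top_iff'.mpr h')
  obtain ⟨a, ha⟩ := Submodule.exists_sub_smul_mem_of_finrank_add_one hW ht (J t)
  have hmem : (a ^ 2 + 1) • t ∈ W := by
    have := W.neg_mem (W.add_mem (h _ ha) (W.smul_mem a ha))
    convert this using 1
    rw [map_sub, map_smul, hJ]
    module
  exact ht ((W.smul_mem_iff (by positivity)).mp hmem)


/-- If `𝔤` is an almost abelian real Lie algebra with abelian ideal `𝔫` of
codimension one and `J` is an abelian complex structure on `𝔤`, then `⁅X, Y⁆ = 0` for every
`X ∈ 𝔤` and every `Y ∈ 𝔫 ∩ J(𝔫)`; consequently the derived algebra `[𝔤, 𝔤]` has dimension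
at most `1`. -/
theorem abelian_complex_structure_on_almost_abelian
    (g : Type) [LieRing g] [LieAlgebra ℝ g] [FiniteDimensional ℝ g]
    (𝔫 : Submodule ℝ g)
    (h_ideal : ∀ (x : g), ∀ y ∈ 𝔫, ⁅x, y⁆ ∈ 𝔫)
    (h_abelian : ∀ x ∈ 𝔫, ∀ y ∈ 𝔫, ⁅x, y⁆ = (0 : g))
    (h_codim : Module.finrank ℝ ↥𝔫 + 1 = Module.finrank ℝ g)
    (J : g →ₗ[ℝ] g)
    (hJ2 : ∀ x : g, J (J x) = -x)
    (hJab : ∀ x y : g, ⁅J x, J y⁆ = ⁅x, y⁆) :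
    (∀ (X : g), ∀ Y ∈ 𝔫 ⊓ Submodule.map J 𝔫, ⁅X, Y⁆ = (0 : g))
    ∧ Module.finrank ℝ
        ↥(Submodule.span ℝ {z : g | ∃ x y : g, z = ⁅x, y⁆}) ≤ 1 := by
  obtain ⟨e, he, hJe⟩ := exists_mem_apply_notMem_of_complex_structure h_codim J hJ2
  have hdecomp := Submodule.exists_sub_smul_mem_of_finrank_add_one h_codim hJe
  have hcentral : ∀ X : g, ∀ Y ∈ 𝔫 ⊓ Submodule.map J 𝔫, ⁅X, Y⁆ = (0 : g) := by
    rintro X Y ⟨hY, w, hw, rfl⟩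
    obtain ⟨a, ha⟩ := hdecomp X
    have h := h_abelian _ ha _ hY
    rwa [sub_lie, smul_lie, hJab, h_abelian e he w hw, smul_zero, sub_zero] at h
  refine ⟨hcentral, ?_⟩
  have hbracket : ∀ u ∈ 𝔫, ∃ c : ℝ, ⁅J e, u⁆ = c • ⁅J e, e⁆ := by
    intro u hu
    obtain ⟨c, hc⟩ := hdecomp (J u)
    have hmem : u - c • e ∈ 𝔫 ⊓ Submodule.map J 𝔫 := by
      refine ⟨𝔫.sub_mem hu (𝔫.smul_mem c he), _, 𝔫.neg_mem hc, ?_⟩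
      rw [map_neg, map_sub, map_smul, hJ2, hJ2]
      module
    have h := hcentral (J e) _ hmem
    rw [lie_sub, lie_smul, sub_eq_zero] at h
    exact ⟨c, h⟩
  have hle : Submodule.span ℝ {z : g | ∃ x y : g, z = ⁅x, y⁆} ≤ Submodule.span ℝ {⁅J e, e⁆} := by
    rw [Submodule.span_le]
    rintro z ⟨x, y, rfl⟩
    obtain ⟨a, ha⟩ := hdecomp x
    obtain ⟨b, hb⟩ := hdecomp y
    obtain ⟨c, hc⟩ := hbracket _ ha
    obtain ⟨d, hd⟩ := hbracket _ hb
    have hxy := h_abelian _ ha _ hb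
    refine Submodule.mem_span_singleton.mpr ⟨a * d - b * c, ?_⟩
    rw [sub_smul, mul_smul, mul_smul, ← hc, ← hd]
    simp only [lie_sub, sub_lie, lie_smul, smul_lie, lie_self, smul_zero, sub_zero] at hxy ⊢
    rw [← lie_skew x (J e), smul_neg] at hxy
    rw [← sub_eq_zero, ← neg_eq_zero, ← hxy]
    abel
  exact (Submodule.finrank_mono hle).trans
    ((finrank_span_le_card _).trans (by simp))
end

section
/- For all real numbers t and r with t ≠ 0 and sin(tr) ≠ 0, the real 5×5 matrix M(t, r) = [[e^t, 0, 0, 0, 0], [0, e^t, 0, 0, 0], [0, 0, e^{−t}cos(tr), e^{−t}sin(tr), 0], [0, 0, −e^{−t}sin(tr), e^{−t}cos(tr), 0], [0, 0, 0, 0, 1]] is not conjugate in GL(5, ℝ) to a matrix all of whose entries are integers. -/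
open Matrix

/-- The matrix of `exp(t·ad_{f₆})` on the abelian ideal of the Lie algebra `𝔟₇`. -/
noncomputable def expAdMatrix (t r : ℝ) : Matrix (Fin 5) (Fin 5) ℝ :=
  !![Real.exp t, 0, 0, 0, 0;
     0, Real.exp t, 0, 0, 0;
     0, 0, Real.exp (-t) * Real.cos (t*r), Real.exp (-t) * Real.sin (t*r), 0;
     0, 0, -(Real.exp (-t) * Real.sin (t*r)), Real.exp (-t) * Real.cos (t*r), 0;
     0, 0, 0, 0, 1]

open Polynomial

theorem expAdMatrix_charpoly (t r : ℝ) :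
    (expAdMatrix t r).charpoly =
      (X - C (Real.exp t)) ^ 2 *
        (((X - C (Real.exp (-t) * Real.cos (t * r))) ^ 2 +
          C (Real.exp (-t) * Real.sin (t * r)) ^ 2) * (X - 1)) := by
  simp [Matrix.charpoly, Matrix.charmatrix, expAdMatrix, Matrix.det_succ_row_zero,
    Fin.sum_univ_succ, Fin.succAbove, Matrix.diagonal]
  ring

/-- The square of the minimal polynomial of a double root of `p` divides `p`. -/
theorem minpoly_sq_dvd_of_double_root {p : ℚ[X]} {a : ℝ} (ha : aeval a p = 0)
    (ha' : aeval a (derivative p) = 0) (hint : IsIntegral ℚ a) :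
    minpoly ℚ a ^ 2 ∣ p := by
  obtain ⟨h, rfl⟩ := minpoly.dvd ℚ a ha
  have hsep : aeval a (derivative (minpoly ℚ a)) ≠ 0 :=
    (minpoly.irreducible hint).separable.aeval_derivative_ne_zero (minpoly.aeval ℚ a)
  have hh : aeval a h = 0 := by
    simpa [derivative_mul, hsep] using ha'
  rw [pow_two]
  exact mul_dvd_mul_left _ (minpoly.dvd ℚ a hh)

/-- A monic rational quadratic polynomial cannot vanish at both a real and a nonreal number. -/
theorem aeval_ne_zero_of_natDegree_two {m : ℚ[X]} (hm : m.Monic) (hdeg : m.natDegree = 2)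
    {a : ℝ} (ha : aeval a m = 0) {z : ℂ} (hz : z.im ≠ 0) : aeval z m ≠ 0 := by
  intro hzm
  have hm2 : m.coeff 2 = 1 := by rw [← hdeg]; exact hm
  rw [aeval_eq_sum_range, hdeg] at ha hzm
  simp only [Finset.sum_range_succ, Finset.sum_range_zero, hm2, Algebra.smul_def] at ha hzm
  have h1 := congrArg Complex.re hzm
  have h2 := congrArg Complex.im hzm
  simp [pow_two] at ha h1 h2
  have h3 : (m.coeff 1 : ℝ) = -2 * z.re := by
    apply mul_right_cancel₀ hz
    linarith
  rw [h3] at ha h1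
  nlinarith [sq_nonneg (a - z.re), sq_pos_of_ne_zero hz]

theorem aeval_ne_zero_of_natDegree_one {h : ℚ[X]} (hdeg : h.natDegree = 1)
    {z : ℂ} (hz : z.im ≠ 0) : aeval z h ≠ 0 := by
  intro hzh
  have hh : h.coeff 1 ≠ 0 := by
    rw [← hdeg]
    exact leadingCoeff_ne_zero.mpr (by rintro rfl; simp at hdeg)
  rw [aeval_eq_sum_range, hdeg] at hzh
  simp only [Finset.sum_range_succ, Finset.sum_range_zero, Algebra.smul_def] at hzh
  have h2 := congrArg Complex.im hzh
  simp [hh, hz] at h2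

/-- A monic integer polynomial with constant term `-1` whose root `a` has rational minimal
polynomial of degree one satisfies `a ^ 2 = 1`. -/
theorem sq_eq_one_of_natDegree_minpoly_eq_one {p : ℤ[X]} (hp : p.Monic) (hp0 : p.eval 0 = -1)
    {a : ℝ} (ha : aeval a p = 0) (hdeg : (minpoly ℚ a).natDegree = 1) : a ^ 2 = 1 := by
  obtain ⟨q, rfl⟩ := minpoly.natDegree_eq_one_iff.mp hdeg
  have hq : aeval q p = 0 := by
    rwa [aeval_algebraMap_apply, map_eq_zero] at ha
  obtain ⟨n, rfl⟩ := IsIntegrallyClosed.isIntegral_iff.mp (show IsIntegral ℤ q from ⟨p, hp, hq⟩)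
  have hn : p.eval n = 0 := by
    rw [aeval_algebraMap_apply, map_eq_zero_iff _ (algebraMap ℤ ℚ).injective_int] at hq
    simpa using hq
  have hdvd := sub_dvd_eval_sub n 0 p
  rw [hn, hp0] at hdvd
  have hu : n ^ 2 = 1 := by
    have : IsUnit n := isUnit_of_dvd_one (by simpa using hdvd)
    exact Int.isUnit_sq this
  have : ((n : ℝ)) ^ 2 = 1 := by exact_mod_cast hu
  simpa using this

/-- For `t ≠ 0` and `sin(tr) ≠ 0`, the matrix `M(t,r)` is not conjugate in
`GL(5,ℝ)` to a matrix with integer entries. -/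
theorem expAdMatrix_not_conjugate_to_integer_matrix
    (t r : ℝ) (ht : t ≠ 0) (hs : Real.sin (t*r) ≠ 0) :
    ¬ ∃ P : Matrix (Fin 5) (Fin 5) ℝ, IsUnit P ∧
        ∀ i j : Fin 5, ∃ z : ℤ, (P * expAdMatrix t r * P⁻¹) i j = (z : ℝ) := by
  rintro ⟨P, hP, hint⟩
  choose N hN using hint
  obtain ⟨U, rfl⟩ := hP
  set p : ℤ[X] := (Matrix.of N).charpoly with hp_def
  have hmonic : p.Monic := Matrix.charpoly_monic _
  have hdeg : p.natDegree = 5 := by simp [hp_def]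
  have hmap : p.map (Int.castRingHom ℝ) = (expAdMatrix t r).charpoly := by
    have hNM : (Matrix.of N).map (Int.castRingHom ℝ) =
        U.val * expAdMatrix t r * (U.val)⁻¹ := by
      ext i j
      simpa using (hN i j).symm
    rw [hp_def, ← Matrix.charpoly_map, hNM, Matrix.charpoly_units_conj]
  rw [expAdMatrix_charpoly] at hmap
  set a := Real.exp t with ha_def
  set c := Real.exp (-t) * Real.cos (t * r) with hc_def
  set s := Real.exp (-t) * Real.sin (t * r) with hs_def
  have hs0 : s ≠ 0 := mul_ne_zero (Real.exp_ne_zero _) hs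
  have hp0 : p.eval 0 = -1 := by
    have h := congrArg (eval 0) hmap
    have hacs : a ^ 2 * (c ^ 2 + s ^ 2) = 1 := by
      have hexp : a * Real.exp (-t) = 1 := by rw [ha_def, ← Real.exp_add]; simp
      rw [hc_def, hs_def]
      linear_combination (a * Real.exp (-t)) ^ 2 * Real.cos_sq_add_sin_sq (t * r) +
        (a * Real.exp (-t) + 1) * hexp
    rw [eval_zero_map] at h
    simp at h
    exact_mod_cast (show ((p.eval 0 : ℤ) : ℝ) = -1 by linarith)
  have hpa : aeval a p = 0 := by
    rw [aeval_def, ← eval_map, algebraMap_int_eq, hmap]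
    simp
  have hpa' : aeval a (derivative p) = 0 := by
    rw [aeval_def, ← eval_map, algebraMap_int_eq, ← derivative_map, hmap]
    simp [derivative_mul, derivative_pow]
  have hpz : aeval (⟨c, s⟩ : ℂ) p = 0 := by
    have h : aeval (⟨c, s⟩ : ℂ) (p.map (algebraMap ℤ ℝ)) = 0 := by
      rw [algebraMap_int_eq, hmap]
      have hz : ((⟨c, s⟩ : ℂ) - (c : ℂ)) ^ 2 + (s : ℂ) ^ 2 = 0 := by
        apply Complex.ext <;> simp [pow_two]
      simp only [map_mul, map_add, map_pow, map_sub, aeval_X, aeval_C, Complex.coe_algebraMap, hz,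
        zero_mul, mul_zero]
    rwa [aeval_map_algebraMap] at h
  have hinta : IsIntegral ℚ a := ⟨p.map (algebraMap ℤ ℚ), hmonic.map _, by
    rw [← aeval_def, aeval_map_algebraMap, hpa]⟩
  obtain ⟨h, hh⟩ := minpoly_sq_dvd_of_double_root (p := p.map (algebraMap ℤ ℚ))
    (by rw [aeval_map_algebraMap, hpa])
    (by rw [derivative_map, aeval_map_algebraMap, hpa']) hinta
  have hμ := minpoly.monic hinta
  have hh0 : h ≠ 0 := by
    rintro rfl
    exact (hmonic.map (algebraMap ℤ ℚ)).ne_zero (by simpa using hh)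
  have hdegs : 5 = 2 * (minpoly ℚ a).natDegree + h.natDegree := by
    rw [← natDegree_pow, ← natDegree_mul (pow_ne_zero _ hμ.ne_zero) hh0, ← hh,
      hmonic.natDegree_map, hdeg]
  have hpos := minpoly.natDegree_pos hinta
  obtain h1 | h2 : (minpoly ℚ a).natDegree = 1 ∨ (minpoly ℚ a).natDegree = 2 := by lia
  · have ha1 := sq_eq_one_of_natDegree_minpoly_eq_one hmonic hp0 hpa h1
    exact ht (Real.exp_eq_one_iff t |>.mp <|
      (pow_eq_one_iff_of_nonneg (Real.exp_pos t).le two_ne_zero).mp ha1)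
  · have hz := congrArg (aeval (⟨c, s⟩ : ℂ)) hh
    rw [aeval_map_algebraMap, hpz, map_mul, map_pow] at hz
    exact mul_ne_zero
      (pow_ne_zero 2 (aeval_ne_zero_of_natDegree_two hμ h2 (minpoly.aeval ℚ a) hs0))
      (aeval_ne_zero_of_natDegree_one (by lia) hs0) hz.symm
end

section
/- For every a ∈ ℝ and every structured real 4×4 matrix A, one has ⟨A, [A, P(a, A)]⟩ = −(w(a, A)/32)·‖[A, Aᵀ]‖². -/
open Matrix

/-- The standard complex structure matrix `J₁` on `ℝ⁴`, sending `u₁ ↦ u₄`, `u₂ ↦ u₃`,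
`u₃ ↦ −u₂`, `u₄ ↦ −u₁`. -/
def J1mat : Matrix (Fin 4) (Fin 4) ℝ :=
  !![0, 0, 0, -1;
     0, 0, -1, 0;
     0, 1, 0, 0;
     1, 0, 0, 0]

/-- A real 4×4 matrix is structured if it commutes with `J₁` and is traceless. -/
def Structured (A : Matrix (Fin 4) (Fin 4) ℝ) : Prop :=
  A * J1mat = J1mat * A ∧ A.trace = 0

/-- The inner product `⟨M, N⟩ = tr(MᵀN)` on 4×4 matrices. -/
def mip (M N : Matrix (Fin 4) (Fin 4) ℝ) : ℝ := (Mᵀ * N).trace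

/-- Commutator `[M, N] = MN − NM`. -/
def mbr (M N : Matrix (Fin 4) (Fin 4) ℝ) : Matrix (Fin 4) (Fin 4) ℝ := M * N - N * M

/-- Symmetric part `M⁺ = (M + Mᵀ)/2`. -/
noncomputable def symPart (M : Matrix (Fin 4) (Fin 4) ℝ) : Matrix (Fin 4) (Fin 4) ℝ :=
  (1/2 : ℝ) • (M + Mᵀ)

/-- Antisymmetric part `M⁻ = (M − Mᵀ)/2`. -/
noncomputable def skewPart (M : Matrix (Fin 4) (Fin 4) ℝ) : Matrix (Fin 4) (Fin 4) ℝ :=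
  (1/2 : ℝ) • (M - Mᵀ)

/-- `w(a,A) = 4a² + 4‖A‖² − (tr(J₁A))²`. -/
noncomputable def wfun (a : ℝ) (A : Matrix (Fin 4) (Fin 4) ℝ) : ℝ :=
  4 * a^2 + 4 * mip A A - ((J1mat * A).trace)^2

/-- `P(a,A) = (w(a,A)/32)·[A,Aᵀ] − (a³/2)·A⁺ − (a/2)·[A⁻, AᵀA]`. -/
noncomputable def Pfun (a : ℝ) (A : Matrix (Fin 4) (Fin 4) ℝ) : Matrix (Fin 4) (Fin 4) ℝ :=
  (wfun a A / 32) • mbr A Aᵀ - (a^3/2) • symPart A - (a/2) • mbr (skewPart A) (Aᵀ * A)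

/-- The entrywise form of a structured matrix. -/
theorem Structured.eq_of {A : Matrix (Fin 4) (Fin 4) ℝ} (hA : Structured A) :
    A = !![A 0 0, A 0 1, A 0 2, A 0 3;
           A 1 0, -A 0 0, A 1 2, A 1 3;
           -A 1 3, -A 1 2, -A 0 0, A 1 0;
           -A 0 3, -A 0 2, A 0 1, A 0 0] := by
  obtain ⟨hcomm, htr⟩ := hA
  have h : ∀ i j, (A * J1mat) i j = (J1mat * A) i j := fun i j => by rw [hcomm]
  simp only [Matrix.mul_apply, J1mat, Fin.sum_univ_four, Fin.forall_fin_succ] at h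
  simp [Matrix.trace, Fin.sum_univ_four] at h htr
  ext i j
  fin_cases i <;> fin_cases j <;> simp <;> linarith

/-- For structured `A`, the commutator `[A, Aᵀ]` is orthogonal to `[A⁻, AᵀA]`. -/
theorem trace_mbr_transpose_mul_mbr_skewPart {A : Matrix (Fin 4) (Fin 4) ℝ}
    (hA : Structured A) :
    (mbr A Aᵀ * mbr (skewPart A) (Aᵀ * A)).trace = 0 := by
  have hform := hA.eq_of
  generalize A 0 0 = a at hform
  generalize A 0 1 = b at hform
  generalize A 0 2 = c at hform
  generalize A 0 3 = d at hform
  generalize A 1 0 = e at hform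
  generalize A 1 2 = f at hform
  generalize A 1 3 = g at hform
  subst hform
  simp only [mbr, skewPart, Matrix.trace, Matrix.diag_apply, Matrix.mul_apply,
    Matrix.sub_apply, Matrix.smul_apply, Matrix.transpose_apply, Fin.sum_univ_four, smul_eq_mul]
  simp
  ring

theorem trace_mbr_transpose_mul_symPart (A : Matrix (Fin 4) (Fin 4) ℝ) :
    (mbr A Aᵀ * symPart A).trace = 0 := by
  have h₁ : (A * Aᵀ * A).trace = (Aᵀ * A * A).trace := by
    rw [Matrix.trace_mul_cycle, Matrix.trace_mul_cycle]
  have h₂ : (A * Aᵀ * Aᵀ).trace = (Aᵀ * A * Aᵀ).trace := by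
    rw [Matrix.trace_mul_cycle, Matrix.trace_mul_cycle]
  simp only [mbr, symPart, Matrix.mul_smul, Matrix.sub_mul, Matrix.mul_add, Matrix.trace_smul,
    Matrix.trace_sub, Matrix.trace_add, h₁, h₂, sub_self]
  simp

theorem mip_mbr_self_right (A P : Matrix (Fin 4) (Fin 4) ℝ) :
    mip A (mbr A P) = -(mbr A Aᵀ * P).trace := by
  simp only [mip, mbr, Matrix.mul_sub, Matrix.sub_mul, Matrix.trace_sub]
  rw [← Matrix.mul_assoc, ← Matrix.mul_assoc, Matrix.trace_mul_cycle Aᵀ P A]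
  ring

theorem transpose_mbr_transpose (A : Matrix (Fin 4) (Fin 4) ℝ) :
    (mbr A Aᵀ)ᵀ = mbr A Aᵀ := by
  simp [mbr]

/-- For every `a ∈ ℝ` and structured `A`,
`⟨A, [A, P(a,A)]⟩ = −(w(a,A)/32)·‖[A, Aᵀ]‖²`. -/
theorem inner_bracket_Pfun
    (a : ℝ) (A : Matrix (Fin 4) (Fin 4) ℝ) (hA : Structured A) :
    mip A (mbr A (Pfun a A)) = -(wfun a A / 32) * mip (mbr A Aᵀ) (mbr A Aᵀ) := by
  rw [mip_mbr_self_right, Pfun, Matrix.mul_sub, Matrix.mul_sub, Matrix.mul_smul, Matrix.mul_smul,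
    Matrix.mul_smul, Matrix.trace_sub, Matrix.trace_sub, Matrix.trace_smul, Matrix.trace_smul,
    Matrix.trace_smul, trace_mbr_transpose_mul_symPart, trace_mbr_transpose_mul_mbr_skewPart hA,
    mip, transpose_mbr_transpose]
  simp
end

section
/- Let I ⊆ ℝ be an interval and let a : I → ℝ and A : I → M₄(ℝ) be differentiable functions with A(t) structured for all t ∈ I, satisfying the bracket-flow system a′(t) = p(a(t), A(t))·a(t) and A′(t) = [A(t), P(a(t), A(t))] + p(a(t), A(t))·A(t). Then for every t ∈ I, (d/dt)( a(t)² + ‖A(t)‖² ) = 2·p(a(t), A(t))·( a(t)² + ‖A(t)‖² ) − (w(a(t), A(t))/16)·‖[A(t), A(t)ᵀ]‖², and this quantity is ≤ 0, vanishing at t if and only if A(t) is skew-symmetric. In particular t ↦ a(t)² + ‖A(t)‖² is non-increasing, and a solution is constant if and only if A takes skew-symmetric values (the Kähler case). -/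
open Matrix

/-- `p(a,A) = (1/32)·((tr(J₁A²))² − w(a,A)·‖A⁺‖²)`. -/
noncomputable def pfun (a : ℝ) (A : Matrix (Fin 4) (Fin 4) ℝ) : ℝ :=
  (1/32) * (((J1mat * (A * A)).trace)^2 - wfun a A * mip (symPart A) (symPart A))

theorem mip_eq_sum (M N : Matrix (Fin 4) (Fin 4) ℝ) :
    mip M N = ∑ i, ∑ j, M i j * N i j := by
  simp only [mip, Matrix.trace, Matrix.diag, Matrix.mul_apply, Matrix.transpose_apply]
  exact Finset.sum_comm

theorem mip_self_nonneg (M : Matrix (Fin 4) (Fin 4) ℝ) : 0 ≤ mip M M := by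
  rw [mip_eq_sum]
  exact Finset.sum_nonneg fun i _ => Finset.sum_nonneg fun j _ => mul_self_nonneg _

theorem mip_self_eq_zero {M : Matrix (Fin 4) (Fin 4) ℝ} : mip M M = 0 ↔ M = 0 := by
  simpa [mip, Matrix.conjTranspose_eq_transpose_of_trivial] using
    Matrix.trace_conjTranspose_mul_self_eq_zero_iff (A := M)

theorem symPart_eq_zero {M : Matrix (Fin 4) (Fin 4) ℝ} : symPart M = 0 ↔ Mᵀ = -M := by
  rw [symPart, smul_eq_zero, eq_neg_iff_add_eq_zero, add_comm]
  norm_num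

theorem mip_self_symPart_pos {A : Matrix (Fin 4) (Fin 4) ℝ} (h : Aᵀ ≠ -A) :
    0 < mip (symPart A) (symPart A) :=
  (mip_self_nonneg _).lt_of_ne' fun h0 => h (symPart_eq_zero.1 (mip_self_eq_zero.1 h0))

theorem Structured.exists_eq {A : Matrix (Fin 4) (Fin 4) ℝ} (hA : Structured A) :
    ∃ x b c d e f g : ℝ,
      A = !![x, b, c, d; e, -x, f, g; -g, -f, -x, e; -d, -c, b, x] := by
  obtain ⟨hJ, htr⟩ := hA
  have h (i j : Fin 4) := congrFun (congrFun hJ i) j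
  simp only [J1mat, Matrix.mul_apply, Fin.sum_univ_four] at h
  simp only [Matrix.trace, Matrix.diag, Fin.sum_univ_four] at htr
  have h00 := h 0 0
  have h01 := h 0 1
  have h02 := h 0 2
  have h03 := h 0 3
  have h10 := h 1 0
  have h11 := h 1 1
  have h12 := h 1 2
  have h13 := h 1 3
  simp at h00 h01 h02 h03 h10 h11 h12 h13
  refine ⟨A 0 0, A 0 1, A 0 2, A 0 3, A 1 0, A 1 2, A 1 3, ?_⟩
  ext i j
  fin_cases i <;> fin_cases j <;> simp <;> linarith

theorem mip_mbr_mbr_transpose (A : Matrix (Fin 4) (Fin 4) ℝ) :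
    mip A (mbr A (mbr A Aᵀ)) = -mip (mbr A Aᵀ) (mbr A Aᵀ) := by
  simp only [mip, mbr, Matrix.transpose_sub, Matrix.transpose_mul, Matrix.transpose_transpose,
    mul_sub, sub_mul, Matrix.trace_sub]
  rw [Matrix.trace_mul_comm Aᵀ (A * Aᵀ * A), Matrix.trace_mul_comm Aᵀ (Aᵀ * A * A)]
  simp only [mul_assoc]
  rw [Matrix.trace_mul_comm Aᵀ (A * (Aᵀ * A))]
  have hcyc := Matrix.trace_mul_comm (Aᵀ * A) (A * Aᵀ)
  simp only [mul_assoc] at hcyc ⊢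
  linarith

theorem mip_mbr_symPart (A : Matrix (Fin 4) (Fin 4) ℝ) : mip A (mbr A (symPart A)) = 0 := by
  simp only [mip_eq_sum, mbr, symPart, Matrix.sub_apply, Matrix.mul_apply, Matrix.smul_apply,
    Matrix.add_apply, Matrix.transpose_apply, Fin.sum_univ_four, smul_eq_mul]
  ring

theorem Structured.mip_mbr_mbr_skewPart {A : Matrix (Fin 4) (Fin 4) ℝ} (hA : Structured A) :
    mip A (mbr A (mbr (skewPart A) (Aᵀ * A))) = 0 := by
  obtain ⟨x, b, c, d, e, f, g, hA⟩ := hA.exists_eq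
  simp only [mip_eq_sum, mbr, skewPart, Matrix.sub_apply, Matrix.smul_apply,
    Matrix.transpose_apply, Matrix.mul_apply, Fin.sum_univ_four, smul_eq_mul]
  simp only [hA, Matrix.of_apply, Matrix.cons_val]
  ring

theorem Structured.mip_mbr_Pfun {A : Matrix (Fin 4) (Fin 4) ℝ} (hA : Structured A) (a : ℝ) :
    mip A (mbr A (Pfun a A)) = -(wfun a A / 32) * mip (mbr A Aᵀ) (mbr A Aᵀ) := by
  have key (r s q : ℝ) (X Y Z : Matrix (Fin 4) (Fin 4) ℝ) :
      mip A (mbr A (r • X - s • Y - q • Z)) =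
        r * mip A (mbr A X) - s * mip A (mbr A Y) - q * mip A (mbr A Z) := by
    simp only [mip, mbr, mul_sub, sub_mul, Matrix.mul_smul, Matrix.smul_mul, Matrix.trace_sub,
      Matrix.trace_smul, smul_eq_mul]
    ring
  rw [Pfun, key, mip_mbr_mbr_transpose, mip_mbr_symPart, hA.mip_mbr_mbr_skewPart]
  ring

theorem Structured.wfun_nonneg {A : Matrix (Fin 4) (Fin 4) ℝ} (hA : Structured A) (a : ℝ) :
    0 ≤ wfun a A := by
  obtain ⟨x, b, c, d, e, f, g, rfl⟩ := hA.exists_eq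
  simp [wfun, J1mat, mip_eq_sum, Matrix.trace, Fin.sum_univ_four]
  nlinarith [sq_nonneg a, sq_nonneg x, sq_nonneg b, sq_nonneg c, sq_nonneg e, sq_nonneg g,
    sq_nonneg (d - f)]

theorem Structured.pfun_le {A : Matrix (Fin 4) (Fin 4) ℝ} (hA : Structured A) (a : ℝ) :
    pfun a A ≤ -(1 / 8) * (a ^ 2 + mip (symPart A) (symPart A)) *
      mip (symPart A) (symPart A) := by
  obtain ⟨x, b, c, d, e, f, g, rfl⟩ := hA.exists_eq
  simp [pfun, wfun, symPart, J1mat, mip_eq_sum, Matrix.trace, Fin.sum_univ_four]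
  -- Cauchy–Schwarz (Lagrange identity) for the traceless Hermitian and skew-Hermitian parts
  nlinarith [sq_nonneg (2 * x * (c + g) - (b + e) * (d - f)),
    sq_nonneg (2 * x * (b - e) + (c - g) * (d - f)),
    sq_nonneg ((b + e) * (b - e) + (c - g) * (c + g))]

theorem hasDerivAt_mip_self {A : ℝ → Matrix (Fin 4) (Fin 4) ℝ}
    {B : Matrix (Fin 4) (Fin 4) ℝ} {t : ℝ}
    (h : ∀ i j, HasDerivAt (fun s => A s i j) (B i j) t) :
    HasDerivAt (fun s => mip (A s) (A s)) (2 * mip (A t) B) t := by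
  simp only [mip_eq_sum, Finset.mul_sum]
  refine HasDerivAt.fun_sum fun i _ => HasDerivAt.fun_sum fun j _ => ?_
  refine ((h i j).fun_mul (h i j)).congr_deriv ?_
  ring

theorem pfun_eq_zero_of_skew {A : Matrix (Fin 4) (Fin 4) ℝ} (h : Aᵀ = -A) (a : ℝ) :
    pfun a A = 0 := by
  have hJ : J1matᵀ = -J1mat := by
    ext i j
    fin_cases i <;> fin_cases j <;> simp [J1mat]
  have htr : (J1mat * (A * A)).trace = 0 := by
    have := Matrix.trace_transpose (J1mat * (A * A))
    rw [Matrix.transpose_mul, Matrix.transpose_mul, h, hJ, Matrix.trace_mul_comm] at this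
    simp at this
    linarith
  have hs : mip (symPart A) (symPart A) = 0 := mip_self_eq_zero.2 (symPart_eq_zero.2 h)
  rw [pfun, htr, hs]
  ring

theorem Pfun_eq_zero_of_skew {A : Matrix (Fin 4) (Fin 4) ℝ} (h : Aᵀ = -A) (a : ℝ) :
    Pfun a A = 0 := by
  have hs : symPart A = 0 := symPart_eq_zero.2 h
  have hk : skewPart A = A := by
    rw [skewPart, h, sub_neg_eq_add, ← two_smul ℝ A, smul_smul]
    norm_num
  rw [Pfun, hs, hk, h]
  simp [mbr, mul_assoc]

/-- Along solutions of the bracket flow,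
`(d/dt)(a² + ‖A‖²) = 2p·(a² + ‖A‖²) − (w/16)·‖[A,Aᵀ]‖² ≤ 0`, vanishing iff `A(t)` is
skew-symmetric; in particular `a² + ‖A‖²` is non-increasing and the solution is constant
iff `A` takes skew-symmetric values. -/
theorem bracket_flow_monotone
    (I : Set ℝ) (hIconv : Convex ℝ I) (hIopen : IsOpen I)
    (a : ℝ → ℝ) (A : ℝ → Matrix (Fin 4) (Fin 4) ℝ)
    (hstr : ∀ t ∈ I, Structured (A t))
    (ha : ∀ t ∈ I, HasDerivAt a (pfun (a t) (A t) * a t) t)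
    (hA : ∀ t ∈ I, ∀ i j : Fin 4, HasDerivAt (fun s => A s i j)
      ((mbr (A t) (Pfun (a t) (A t)) + pfun (a t) (A t) • A t) i j) t) :
    (∀ t ∈ I,
      HasDerivAt (fun s => a s ^ 2 + mip (A s) (A s))
        (2 * pfun (a t) (A t) * (a t ^ 2 + mip (A t) (A t))
          - wfun (a t) (A t) / 16 * mip (mbr (A t) (A t)ᵀ) (mbr (A t) (A t)ᵀ)) t ∧
      (2 * pfun (a t) (A t) * (a t ^ 2 + mip (A t) (A t))
          - wfun (a t) (A t) / 16 * mip (mbr (A t) (A t)ᵀ) (mbr (A t) (A t)ᵀ)) ≤ 0 ∧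
      ((2 * pfun (a t) (A t) * (a t ^ 2 + mip (A t) (A t))
          - wfun (a t) (A t) / 16 * mip (mbr (A t) (A t)ᵀ) (mbr (A t) (A t)ᵀ)) = 0
        ↔ (A t)ᵀ = -(A t)))
    ∧ AntitoneOn (fun t => a t ^ 2 + mip (A t) (A t)) I
    ∧ ((∀ s ∈ I, ∀ t ∈ I, a s = a t ∧ A s = A t) ↔ (∀ t ∈ I, (A t)ᵀ = -(A t))) := by
  have hderiv : ∀ t ∈ I, HasDerivAt (fun s => a s ^ 2 + mip (A s) (A s))
      (2 * pfun (a t) (A t) * (a t ^ 2 + mip (A t) (A t))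
        - wfun (a t) (A t) / 16 * mip (mbr (A t) (A t)ᵀ) (mbr (A t) (A t)ᵀ)) t := by
    intro t ht
    refine (((ha t ht).fun_pow 2).fun_add (hasDerivAt_mip_self (hA t ht))).congr_deriv ?_
    have hadd : mip (A t) (mbr (A t) (Pfun (a t) (A t)) + pfun (a t) (A t) • A t) =
        mip (A t) (mbr (A t) (Pfun (a t) (A t))) + pfun (a t) (A t) * mip (A t) (A t) := by
      simp [mip, mul_add]
    rw [hadd, (hstr t ht).mip_mbr_Pfun]
    push_cast
    ring
  have hterm : ∀ t ∈ I,
      0 ≤ wfun (a t) (A t) / 16 * mip (mbr (A t) (A t)ᵀ) (mbr (A t) (A t)ᵀ) := fun t ht =>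
    mul_nonneg (div_nonneg ((hstr t ht).wfun_nonneg _) (by norm_num)) (mip_self_nonneg _)
  have hskew : ∀ t ∈ I, (A t)ᵀ = -(A t) →
      2 * pfun (a t) (A t) * (a t ^ 2 + mip (A t) (A t))
        - wfun (a t) (A t) / 16 * mip (mbr (A t) (A t)ᵀ) (mbr (A t) (A t)ᵀ) = 0 := by
    intro t ht h
    have hbr : mbr (A t) (A t)ᵀ = 0 := by simp [mbr, h]
    rw [pfun_eq_zero_of_skew h, hbr]
    simp [mip]
  have hneg : ∀ t ∈ I, (A t)ᵀ ≠ -(A t) →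
      2 * pfun (a t) (A t) * (a t ^ 2 + mip (A t) (A t))
        - wfun (a t) (A t) / 16 * mip (mbr (A t) (A t)ᵀ) (mbr (A t) (A t)ᵀ) < 0 := by
    intro t ht h
    have hS := mip_self_symPart_pos h
    have hp : pfun (a t) (A t) < 0 := by
      refine ((hstr t ht).pfun_le (a t)).trans_lt ?_
      have : 0 < (a t ^ 2 + mip (symPart (A t)) (symPart (A t))) *
          mip (symPart (A t)) (symPart (A t)) := by positivity
      linarith
    have hM : 0 < mip (A t) (A t) := by
      refine (mip_self_nonneg _).lt_of_ne' fun h0 => h ?_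
      simp [mip_self_eq_zero.1 h0]
    have hprod : pfun (a t) (A t) * (a t ^ 2 + mip (A t) (A t)) < 0 :=
      mul_neg_of_neg_of_pos hp (by positivity)
    linarith [hterm t ht]
  have hle : ∀ t ∈ I, 2 * pfun (a t) (A t) * (a t ^ 2 + mip (A t) (A t))
      - wfun (a t) (A t) / 16 * mip (mbr (A t) (A t)ᵀ) (mbr (A t) (A t)ᵀ) ≤ 0 := by
    intro t ht
    by_cases h : (A t)ᵀ = -(A t)
    · exact (hskew t ht h).le
    · exact (hneg t ht h).le
  have hiff : ∀ t ∈ I, 2 * pfun (a t) (A t) * (a t ^ 2 + mip (A t) (A t))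
      - wfun (a t) (A t) / 16 * mip (mbr (A t) (A t)ᵀ) (mbr (A t) (A t)ᵀ) = 0 ↔
        (A t)ᵀ = -(A t) := fun t ht =>
    ⟨fun h0 => by_contra fun h => (hneg t ht h).ne h0, hskew t ht⟩
  refine ⟨fun t ht => ⟨hderiv t ht, hle t ht, hiff t ht⟩, ?_, ?_, ?_⟩
  · refine antitoneOn_of_hasDerivWithinAt_nonpos hIconv
      (fun t ht => (hderiv t ht).continuousAt.continuousWithinAt)
      (fun t ht => (hderiv t (interior_subset ht)).hasDerivWithinAt)
      fun t ht => hle t (interior_subset ht)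
  · intro hconst t ht
    refine (hiff t ht).1 ((hderiv t ht).unique ?_)
    refine (hasDerivAt_const t (a t ^ 2 + mip (A t) (A t))).congr_of_eventuallyEq ?_
    filter_upwards [hIopen.mem_nhds ht] with s hs
    rw [(hconst s hs t ht).1, (hconst s hs t ht).2]
  · intro h s hs t ht
    have hzero {f : ℝ → ℝ} (hf : ∀ r ∈ I, HasDerivAt f 0 r) : f s = f t :=
      hIconv.is_const_of_fderivWithin_eq_zero (𝕜 := ℝ)
        (fun r hr => (hf r hr).differentiableAt.differentiableWithinAt)
        (fun r hr => by
          rw [fderivWithin_of_isOpen hIopen hr]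
          ext
          simp [(hf r hr).deriv]) hs ht
    refine ⟨hzero fun r hr => ?_, ?_⟩
    · simpa [pfun_eq_zero_of_skew (h r hr)] using ha r hr
    · ext i j
      refine hzero (f := fun r => A r i j) fun r hr => ?_
      simpa [pfun_eq_zero_of_skew (h r hr), Pfun_eq_zero_of_skew (h r hr), mbr] using hA r hr i j
end

section
/- Let (𝔤, J, ⟨·,·⟩) be a Hermitian almost abelian Lie algebra with abelian ideal 𝔫 of codimension one, and let ∇^C be its Chern connection. Then ∇^C_X Y = 0 for every X ∈ 𝔫 ∩ J𝔫 and every Y ∈ 𝔤. -/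
/-- Exterior derivative of a 2-form on a Lie algebra. -/
def lieD2 {g : Type} [LieRing g] [LieAlgebra ℝ g] (ω : g → g → ℝ) (x y z : g) : ℝ :=
  -ω ⁅x, y⁆ z + ω ⁅x, z⁆ y - ω ⁅y, z⁆ x

/-- A codimension-one subspace has a complement spanned by a single vector. -/
theorem exists_forall_sub_smul_mem_of_finrank_add_one {K V : Type*} [Field K] [AddCommGroup V]
    [Module K V] [FiniteDimensional K V] (W : Submodule K V)
    (h : Module.finrank K W + 1 = Module.finrank K V) :
    ∃ v : V, ∀ w : V, ∃ c : K, w - c • v ∈ W := by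
  have hq : Module.finrank K (V ⧸ W) = 1 := by
    have := W.finrank_quotient_add_finrank
    omega
  obtain ⟨q, -, hspan⟩ := finrank_eq_one_iff'.mp hq
  obtain ⟨v, rfl⟩ := W.mkQ_surjective q
  refine ⟨v, fun w => ?_⟩
  obtain ⟨c, hc⟩ := hspan (W.mkQ w)
  refine ⟨c, (Submodule.Quotient.mk_eq_zero W).mp ?_⟩
  rw [← Submodule.mkQ_apply, map_sub, map_smul, hc, sub_self]

/-- A real linear map commuting with complex structures and vanishing on a subspace of real
codimension one is zero. -/
theorem apply_eq_zero_of_comm_complex_structure {V : Type*} [AddCommGroup V] [Module ℝ V]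
    [FiniteDimensional ℝ V] {J L : V →ₗ[ℝ] V} (hJ2 : ∀ x, J (J x) = -x)
    (hLJ : ∀ x, L (J x) = J (L x)) {W : Submodule ℝ V}
    (hW : Module.finrank ℝ W + 1 = Module.finrank ℝ V) (hL : ∀ x ∈ W, L x = 0) (y : V) :
    L y = 0 := by
  obtain ⟨v, hv⟩ := exists_forall_sub_smul_mem_of_finrank_add_one W hW
  have hLv : ∀ w, ∃ c : ℝ, L w = c • L v := fun w => by
    obtain ⟨c, hc⟩ := hv w
    have := hL _ hc
    rw [map_sub, map_smul, sub_eq_zero] at this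
    exact ⟨c, this⟩
  obtain ⟨c, hc⟩ := hLv (J v)
  rw [hLJ] at hc
  have hsq : -L v = (c * c) • L v := by
    rw [← hJ2, hc, map_smul, hc, smul_smul]
  have hzero : (c * c + 1) • L v = 0 := by
    rw [add_smul, one_smul, ← hsq, neg_add_cancel]
  have hv0 : L v = 0 := (smul_eq_zero.mp hzero).resolve_left (by nlinarith [mul_self_nonneg c])
  obtain ⟨d, hd⟩ := hLv y
  rw [hd, hv0, smul_zero]

/-- For a Hermitian almost abelian Lie algebra with abelian ideal `𝔫` of
codimension one, the Chern connection satisfies `∇^C_X Y = 0` for every `X ∈ 𝔫 ∩ J𝔫`. -/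
theorem chern_connection_vanishes_on_n1
    (g : Type) [LieRing g] [LieAlgebra ℝ g] [FiniteDimensional ℝ g]
    (ip : g →ₗ[ℝ] g →ₗ[ℝ] ℝ)
    (hsymm : ∀ x y : g, ip x y = ip y x)
    (hpos : ∀ x : g, x ≠ 0 → 0 < ip x x)
    (J : g →ₗ[ℝ] g)
    (hJ2 : ∀ x : g, J (J x) = -x)
    (hJorth : ∀ x y : g, ip (J x) (J y) = ip x y)
    (hJint : ∀ x y : g, ⁅J x, J y⁆ = ⁅x, y⁆ + J ⁅J x, y⁆ + J ⁅x, J y⁆)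
    -- almost abelian: 𝔫 an abelian ideal of codimension one
    (𝔫 : Submodule ℝ g)
    (hideal : ∀ (x : g), ∀ y ∈ 𝔫, ⁅x, y⁆ ∈ 𝔫)
    (habelian : ∀ x ∈ 𝔫, ∀ y ∈ 𝔫, ⁅x, y⁆ = (0 : g))
    (hcodim : Module.finrank ℝ ↥𝔫 + 1 = Module.finrank ℝ g)
    -- Levi-Civita product:
    (LC : g → g → g)
    (hLC : ∀ x y z : g,
      2 * ip (LC x y) z = ip ⁅x, y⁆ z - ip ⁅y, z⁆ x - ip ⁅x, z⁆ y)
    -- Chern connection: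
    (nC : g → g → g)
    (hnC : ∀ x y z : g, ip (nC x y) z =
      ip (LC x y) z - (1/2) * lieD2 (fun p q => ip (J p) q) (J x) y z) :
    ∀ X ∈ 𝔫 ⊓ Submodule.map J 𝔫, ∀ Y : g, nC X Y = 0 := by
  rintro X ⟨hX, Z₀, hZ₀, rfl⟩ Y
  set X := J Z₀
  have hJX : J X ∈ 𝔫 := by
    rw [hJ2]
    exact 𝔫.neg_mem hZ₀
  clear_value X
  let L : g →ₗ[ℝ] g :=
    (LieAlgebra.ad ℝ g X : g →ₗ[ℝ] g) + J ∘ₗ (LieAlgebra.ad ℝ g (J X) : g →ₗ[ℝ] g)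
  have hL_apply : ∀ y, L y = ⁅X, y⁆ + J ⁅J X, y⁆ := fun _ => rfl
  have hLJ : ∀ y, L (J y) = J (L y) := fun y => by
    have h := congrArg J (hJint X y)
    simp only [map_add, hJ2] at h
    rw [hL_apply, hL_apply, h, map_add, hJ2]
    abel
  have hL_𝔫 : ∀ y ∈ 𝔫, L y = 0 := fun y hy => by
    rw [hL_apply, habelian X hX y hy, habelian _ hJX y hy, map_zero, add_zero]
  have hL : ∀ y, ⁅X, y⁆ + J ⁅J X, y⁆ = 0 :=
    apply_eq_zero_of_comm_complex_structure hJ2 hLJ hcodim hL_𝔫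
  have hnC_zero : ∀ z, ip (nC X Y) z = 0 := fun z => by
    have hY := congrArg (fun u => ip u z) (hL Y)
    have hz := congrArg (fun u => ip u Y) (hL z)
    simp only [map_add, LinearMap.add_apply, map_zero, LinearMap.zero_apply] at hY hz
    have h := hnC X Y z
    simp only [lieD2, hJorth] at h
    linarith [hLC X Y z]
  by_contra hne
  exact (hpos _ hne).ne' (hnC_zero _)
end
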